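/- Every n-extendable graph has minimum degree at least n+1; that is, if G is n-extendable, then every vertex of G has degree at least n+1. -/

import Mathlib

/-- A graph `G` on a finite vertex type is `n`-extendable if it is connected, has at
least `2n+2` vertices, has a matching with `n` edges, and every matching with `n`
edges is contained in a perfect matching of `G`. -/
def SimpleGraph.IsNExtendable {V : Type*} [Fintype V] (G : SimpleGraph V) (n : ℕ) : Prop :=
  G.Connected ∧ 2 * n + 2 ≤ Fintype.card V ∧
    (∃ M : G.Subgraph, M.IsMatching ∧ M.edgeSet.ncard = n) ∧
    ∀ M : G.Subgraph, M.IsMatching → M.edgeSet.ncard = n →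
      ∃ M' : G.Subgraph, M'.IsPerfectMatching ∧ M ≤ M'

namespace NExt

open Classical in
/-- the subgraph induced on the set has a perfect matching -/
inductive PM {V : Type*} (G : SimpleGraph V) : Finset V → Prop
  | nil : PM G ∅
  | step (W : Finset V) (x y : V) : x ∈ W → y ∈ W → G.Adj x y → PM G (W \ {x, y}) → PM G W

open Classical in
def Ext {V : Type*} (G : SimpleGraph V) : ℕ → Finset V → Prop
  | 0, W => PM G W
  | (n+1), W => PM G W ∧ ∀ x ∈ W, ∀ y ∈ W, G.Adj x y → Ext G n (W \ {x, y})

def Cl {V : Type*} (G : SimpleGraph V) (W A : Finset V) : Prop :=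
  A ⊆ W ∧ ∀ a ∈ A, ∀ b ∈ W, G.Adj a b → b ∈ A

lemma Ext.pm {V : Type*} {G : SimpleGraph V} {n : ℕ} {W : Finset V} (h : Ext G n W) : PM G W := by
  cases n with
  | zero => exact h
  | succ n => exact h.1

open Classical in
lemma PM.even {V : Type*} {G : SimpleGraph V} {W : Finset V} (h : PM G W) :
    ∀ A, Cl G W A → Even A.card := by
  induction h with
  | nil => intro A hA; have := Finset.subset_empty.1 hA.1; simp [this]
  | step W x y hx hy hxy _ ih =>
    intro A hA
    by_cases hxA : x ∈ A
    · have hyA := hA.2 x hxA y hy hxy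
      have h1 := ih (A \ {x, y}) ⟨Finset.sdiff_subset_sdiff hA.1 le_rfl, by
        intro a ha b hb hab
        simp only [Finset.mem_sdiff] at ha hb ⊢
        exact ⟨hA.2 a ha.1 b hb.1 hab, hb.2⟩⟩
      have h2 : ({x, y} : Finset V) ⊆ A := by
        intro z; simp; rintro (rfl | rfl) <;> assumption
      have h3 := Finset.card_sdiff_add_card_eq_card h2
      rw [Finset.card_pair hxy.ne] at h3
      rw [← h3]
      exact h1.add (by decide)
    · have hyA : y ∉ A := fun hyA => hxA (hA.2 y hyA x hx hxy.symm)
      refine ih A ⟨?_, ?_⟩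
      · intro a ha
        have := hA.1 ha
        simp only [Finset.mem_sdiff, Finset.mem_insert, Finset.mem_singleton]
        refine ⟨this, ?_⟩
        rintro (rfl | rfl) <;> contradiction
      · intro a ha b hb hab
        exact hA.2 a ha b (Finset.mem_sdiff.1 hb).1 hab

lemma PM.nbr {V : Type*} {G : SimpleGraph V} {W : Finset V} (h : PM G W) (v : V) (hv : v ∈ W) :
    ∃ x ∈ W, G.Adj v x := by
  by_contra! hc
  have := h.even {v} ⟨by simpa using hv, by
    intro a ha b hb hab
    simp at ha; subst ha
    exact absurd hab (hc b hb)⟩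
  simp at this

open Classical in
noncomputable def comp {V : Type*} (G : SimpleGraph V) (W : Finset V) (v : V) : Finset V :=
  W.filter fun u => ∀ A, Cl G W A → v ∈ A → u ∈ A

lemma comp_cl {V : Type*} (G : SimpleGraph V) (W : Finset V) (v : V) : Cl G W (comp G W v) := by
  refine ⟨by simp [comp], ?_⟩
  intro a ha b hb hab
  simp only [comp, Finset.mem_filter] at ha ⊢
  exact ⟨hb, fun A hA hv => hA.2 a (ha.2 A hA hv) b hb hab⟩

lemma mem_comp {V : Type*} (G : SimpleGraph V) (W : Finset V) (v : V) (hv : v ∈ W) :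
    v ∈ comp G W v := by
  simp [comp, hv]

lemma comp_min {V : Type*} {G : SimpleGraph V} {W A : Finset V} {v : V} (hA : Cl G W A)
    (hv : v ∈ A) : comp G W v ⊆ A := by
  intro u hu
  simp only [comp, Finset.mem_filter] at hu
  exact hu.2 A hA hv

open Classical in
lemma comp_le {V : Type*} {G : SimpleGraph V} {W W' : Finset V} {v : V}
    (hv : v ∈ W) (h : comp G W v ⊆ W') : comp G W v ⊆ comp G W' v := by
  have hB := comp_cl G W' v
  have : Cl G W (comp G W v ∩ comp G W' v) := by
    refine ⟨fun a ha => (comp_cl G W v).1 (Finset.mem_inter.1 ha).1, ?_⟩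
    intro a ha b hb hab
    rw [Finset.mem_inter] at ha ⊢
    have h1 := (comp_cl G W v).2 a ha.1 b hb hab
    exact ⟨h1, hB.2 a ha.2 b (h h1) hab⟩
  have h2 := comp_min this (v := v)
    (Finset.mem_inter.2 ⟨mem_comp G W v hv, mem_comp G W' v (h (mem_comp G W v hv))⟩)
  exact h2.trans Finset.inter_subset_right

open Classical in
theorem main {V : Type*} [Fintype V] (G : SimpleGraph V) (n : ℕ) : ∀ (W : Finset V) (v : V), v ∈ W →
    Ext G n W → (∀ A, Cl G W A → v ∈ A → 2 * n + 2 ≤ A.card) →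
    n + 1 ≤ (W.filter fun u => G.Adj v u).card := by
  induction n with
  | zero =>
    intro W v hv hE _
    obtain ⟨x, hx, hvx⟩ := hE.pm.nbr v hv
    have : 0 < (W.filter fun u => G.Adj v u).card :=
      Finset.card_pos.2 ⟨x, by simp [hx, hvx]⟩
    omega
  | succ n ih =>
    intro W v hv hE hbig
    have hPM : ∀ x ∈ W, ∀ y ∈ W, G.Adj x y → PM G (W \ {x, y}) :=
      fun x hx y hy hxy => (hE.2 x hx y hy hxy).pm
    -- existence of an edge
    have hex : ∃ x ∈ W, ∃ y ∈ W, G.Adj v x ∧ G.Adj x y ∧ y ≠ v := by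
      obtain ⟨x, hx, hvx⟩ := hE.pm.nbr v hv
      by_contra! hc
      have hxo : ∀ y ∈ W, G.Adj x y → y = v := fun y hy => hc x hx y hy hvx
      have hno : ¬ Cl G W {v, x} := by
        intro hcl
        have := hbig _ hcl (by simp)
        rw [Finset.card_pair hvx.ne] at this
        omega
      apply hno
      refine ⟨by intro z; simp; rintro (rfl | rfl) <;> assumption, ?_⟩
      intro a ha b hb hab
      simp only [Finset.mem_insert, Finset.mem_singleton] at ha ⊢
      rcases ha with rfl | rfl
      · by_contra! hbb
        have h1 := (hPM a hv b hb hab).even {x} ⟨by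
          intro z hz; simp at hz; subst hz
          simp [hx, hvx.ne', hbb.2.symm], by
          intro c hc' d hd hcd
          simp only [Finset.mem_singleton] at hc'
          subst hc'
          simp at hd
          exact absurd (hxo d hd.1 hcd) hd.2.1⟩
        simp at h1
      · exact Or.inl (hxo b hb hab)
    let P : Finset (V × V) := Finset.univ.filter fun p =>
      p.1 ∈ W ∧ p.2 ∈ W ∧ G.Adj v p.1 ∧ G.Adj p.1 p.2 ∧ p.2 ≠ v
    have hPne : P.Nonempty := by
      obtain ⟨x, hx, y, hy, h1, h2, h3⟩ := hex
      exact ⟨(x, y), by simp [P, hx, hy, h1, h2, h3]⟩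
    obtain ⟨⟨x, y⟩, hp, hmax⟩ := Finset.exists_max_image P
      (fun p => (comp G (W \ {p.1, p.2}) v).card) hPne
    obtain ⟨hx, hy, hvx, hxy, hyv⟩ : x ∈ W ∧ y ∈ W ∧ G.Adj v x ∧ G.Adj x y ∧ y ≠ v := by
      simpa [P] using hp
    have hmax' : ∀ x' ∈ W, ∀ y' ∈ W, G.Adj v x' → G.Adj x' y' → y' ≠ v →
        (comp G (W \ {x', y'}) v).card ≤ (comp G (W \ {x, y}) v).card := by
      intro x' hx' y' hy' h1 h2 h3
      exact hmax (x', y') (by simp [P, hx', hy', h1, h2, h3])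
    have hvW' : v ∈ W \ {x, y} := by simp [hv, hvx.ne, hyv.symm]
    set C := comp G (W \ {x, y}) v with hC
    have hCcl : Cl G (W \ {x, y}) C := comp_cl _ _ _
    have hvC : v ∈ C := mem_comp _ _ _ hvW'
    have hCW : ∀ c ∈ C, c ∈ W ∧ c ≠ x ∧ c ≠ y := by
      intro c hc
      have := hCcl.1 hc
      simpa using this
    have hCadj : ∀ c ∈ C, ∀ b ∈ W, G.Adj c b → b ≠ x → b ≠ y → b ∈ C := by
      intro c hc b hb hcb h1 h2
      exact hCcl.2 c hc b (by simp [hb, h1, h2]) hcb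
    have hCev : Even C.card := (hPM x hx y hy hxy).even C hCcl
    -- growing contradiction
    have hgrow : ∀ x' ∈ W, ∀ y' ∈ W, G.Adj v x' → G.Adj x' y' → y' ≠ v → x' ∉ C → y' ∉ C →
        ∀ t ∈ W, t ∉ C → t ≠ x' → t ≠ y' → ∀ c ∈ C, ¬ G.Adj c t := by
      intro x' hx' y' hy' h1 h2 h3 hx'C hy'C t ht htC htx hty c hc hct
      have hsub : C ⊆ comp G (W \ {x', y'}) v := by
        apply comp_le hvW'
        intro z hz
        have := hCW z hz
        simp only [Finset.mem_sdiff, Finset.mem_insert, Finset.mem_singleton]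
        refine ⟨this.1, ?_⟩
        rintro (rfl | rfl) <;> contradiction
      have htm := (comp_cl G (W \ {x', y'}) v).2 c (hsub hc) t (by simp [ht, htx, hty]) hct
      have h5 : insert t C ⊆ comp G (W \ {x', y'}) v := Finset.insert_subset htm hsub
      have h6 := Finset.card_le_card h5
      rw [Finset.card_insert_of_notMem htC] at h6
      have := hmax' x' hx' y' hy' h1 h2 h3
      omega
    have hxC : x ∉ C := fun h => (hCW x h).2.1 rfl
    have hyC : y ∉ C := fun h => (hCW y h).2.2 rfl
    have hCbig : 2 * n + 2 ≤ C.card := by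
      by_contra! hsmall
      -- no neighbour of x outside
      have hx1 : ∀ w ∈ W, G.Adj x w → w ∈ C ∨ w = y := by
        by_contra! hc
        obtain ⟨w, hw, hxw, hwC, hwy⟩ := hc
        have hyn := hgrow x hx w hw hvx hxw (fun h => hwC (h ▸ hvC)) hxC hwC y hy hyC hxy.ne' hwy.symm
        have h1 := (hPM x hx v hv hvx.symm).even (C.erase v) ⟨by
          intro z hz
          have hz' := Finset.mem_erase.1 hz
          have := hCW z hz'.2
          simp [this, hz'.1], by
          intro a ha b hb hab
          rw [Finset.mem_erase] at ha ⊢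
          simp at hb
          refine ⟨hb.2.2, hCadj a ha.2 b hb.1 hab hb.2.1 ?_⟩
          rintro rfl
          exact hyn a ha.2 hab⟩
        rw [Finset.card_erase_of_mem hvC] at h1
        have h0 : 0 < C.card := Finset.card_pos.2 ⟨v, hvC⟩
        rw [Nat.even_iff] at h1 hCev
        omega
      have hy1 : ∀ w ∈ W, G.Adj y w → w ∈ C ∨ w = x := by
        by_contra! hc
        obtain ⟨w, hw, hyw, hwC, hwx⟩ := hc
        have h1 := (hPM y hy w hw hyw).even (insert x C) ⟨by
          intro z hz
          rcases Finset.mem_insert.1 hz with rfl | hz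
          · simp [hx, hxy.ne, hwx.symm]
          · have := hCW z hz
            have hzw : z ≠ w := fun h => hwC (h ▸ hz)
            simp [this, hzw], by
          intro a ha b hb hab
          simp at hb
          rcases Finset.mem_insert.1 ha with rfl | ha
          · rcases hx1 b hb.1 hab with h | h
            · exact Finset.mem_insert_of_mem h
            · exact absurd h hb.2.1
          · by_cases hbx : b = x
            · simp [hbx]
            · exact Finset.mem_insert_of_mem (hCadj a ha b hb.1 hab hbx hb.2.1)⟩
        rw [Finset.card_insert_of_notMem hxC] at h1
        rw [Nat.even_iff] at h1 hCev
        omega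
      have h1 := hbig (insert x (insert y C)) ⟨by
        intro z hz
        simp only [Finset.mem_insert] at hz
        rcases hz with rfl | rfl | hz
        · exact hx
        · exact hy
        · exact (hCW z hz).1, by
        intro a ha b hb hab
        simp only [Finset.mem_insert] at ha ⊢
        rcases ha with rfl | rfl | ha
        · rcases hx1 b hb hab with h | h <;> simp [h]
        · rcases hy1 b hb hab with h | h <;> simp [h]
        · by_cases h1 : b = x
          · simp [h1]
          · by_cases h2 : b = y
            · simp [h2]
            · simp [hCadj a ha b hb hab h1 h2]⟩ (by simp [hvC])
      have h2 := Finset.card_insert_le x (insert y C)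
      have h3 := Finset.card_insert_le y C
      omega
    have key := ih (W \ {x, y}) v hvW' (hE.2 x hx y hy hxy) (by
      intro A hA hvA
      exact hCbig.trans (Finset.card_le_card (comp_min hA hvA)))
    have hlt : ((W \ {x, y}).filter fun u => G.Adj v u).card <
        (W.filter fun u => G.Adj v u).card := by
      apply Finset.card_lt_card
      rw [Finset.ssubset_iff_of_subset (Finset.filter_subset_filter _ Finset.sdiff_subset)]
      exact ⟨x, by simp [hx, hvx], by simp⟩
    omega

open SimpleGraph

structure Good {V : Type*} {G : SimpleGraph V} (M : G.Subgraph) (k : ℕ) : Prop where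
  mat : M.IsMatching
  edg : M.edgeSet.ncard = k
  vts : M.verts.ncard = 2 * k

lemma Good.bot {V : Type*} {G : SimpleGraph V} : Good (⊥ : G.Subgraph) 0 :=
  ⟨fun v hv => by simp at hv, by simp, by simp⟩

lemma Good.add {V : Type*} [Finite V] {G : SimpleGraph V} {M : G.Subgraph} {k : ℕ} (h : Good M k)
    {p q : V} (hpq : G.Adj p q) (hp : p ∉ M.verts) (hq : q ∉ M.verts) :
    Good (M ⊔ G.subgraphOfAdj hpq) (k + 1) := by
  refine ⟨?_, ?_, ?_⟩
  · apply h.mat.sup (Subgraph.IsMatching.subgraphOfAdj hpq)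
    rw [h.mat.support_eq_verts, (Subgraph.IsMatching.subgraphOfAdj hpq).support_eq_verts]
    rw [Set.disjoint_left]
    intro a ha hb
    simp at hb
    rcases hb with rfl | rfl <;> contradiction
  · rw [Subgraph.edgeSet_sup, edgeSet_subgraphOfAdj, Set.union_singleton,
      Set.ncard_insert_of_notMem _ (Set.toFinite _), h.edg]
    intro hh
    exact hp (M.edge_vert (Subgraph.mem_edgeSet.1 hh))
  · have : (M ⊔ G.subgraphOfAdj hpq).verts = insert p (insert q M.verts) := by
      ext z; simp
    rw [this, Set.ncard_insert_of_notMem _ (Set.toFinite _),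
      Set.ncard_insert_of_notMem hq (Set.toFinite _), h.vts]
    · ring
    · simp [hp, hpq.ne]

lemma extend {V : Type*} [Fintype V] {G : SimpleGraph V} {n : ℕ} (h : G.IsNExtendable n) (j : ℕ) :
    ∀ (M F : G.Subgraph) (k : ℕ), Good M k → F.IsPerfectMatching → M ≤ F → k + 1 + j = n →
    ∀ x y, ∀ hxy : G.Adj x y, x ∉ M.verts → y ∉ M.verts →
    ∃ F' : G.Subgraph, F'.IsPerfectMatching ∧ M ⊔ G.subgraphOfAdj hxy ≤ F' := by
  induction j with
  | zero =>
    intro M F k hM hF hMF hk x y hxy hx hy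
    have h1 := hM.add hxy hx hy
    exact h.2.2.2 _ h1.mat (by rw [h1.edg]; omega)
  | succ j ih =>
    intro M F k hM hF hMF hk x y hxy hx hy
    have hF' := Subgraph.isPerfectMatching_iff.1 hF
    obtain ⟨x', hx', -⟩ := hF' x
    obtain ⟨y', hy', -⟩ := hF' y
    have hM2 := hM.add hxy hx hy
    have hcard : (insert x' (insert y' (M ⊔ G.subgraphOfAdj hxy).verts)).ncard <
        (Set.univ : Set V).ncard := by
      have h1 := Set.ncard_insert_le x' (insert y' (M ⊔ G.subgraphOfAdj hxy).verts)
      have h2 := Set.ncard_insert_le y' (M ⊔ G.subgraphOfAdj hxy).verts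
      rw [hM2.vts] at h2
      rw [Set.ncard_univ, Nat.card_eq_fintype_card]
      have := h.2.1
      omega
    obtain ⟨p, -, hp⟩ := Set.exists_mem_notMem_of_ncard_lt_ncard hcard
    have hpx' : p ≠ x' := fun e => hp (by simp [e])
    have hpy' : p ≠ y' := fun e => hp (by simp [e])
    have hpx : p ≠ x := fun e => hp (by simp [e])
    have hpy : p ≠ y := fun e => hp (by simp [e])
    have hpM : p ∉ M.verts := fun e => hp (by simp [e])
    obtain ⟨q, hpq, -⟩ := hF' p
    have hqM : q ∉ M.verts := by
      intro hq
      obtain ⟨r, hr, -⟩ := hM.mat hq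
      have h1 := hMF.2 hr
      have h2 := hF.1.eq_of_adj_left h1 hpq.symm
      subst h2
      exact hpM (M.edge_vert hr.symm)
    have hqx : q ≠ x := by
      rintro rfl
      exact hpx' (hF.1.eq_of_adj_left hpq.symm hx')
    have hqy : q ≠ y := by
      rintro rfl
      exact hpy' (hF.1.eq_of_adj_left hpq.symm hy')
    obtain ⟨F', h1, h2⟩ := ih (M ⊔ G.subgraphOfAdj hpq.adj_sub) F (k+1)
      (hM.add hpq.adj_sub hpM hqM) hF
      (sup_le hMF (subgraphOfAdj_le_of_adj F hpq)) (by omega) x y hxy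
      (by simp [hx, Ne.symm hpx, hqx.symm]) (by simp [hy, Ne.symm hpy, hqy.symm])
    exact ⟨F', h1, le_trans (sup_le_sup_right le_sup_left _) h2⟩

open Classical in
lemma pm_of {V : Type*} {G : SimpleGraph V} {F : G.Subgraph} (hF : F.IsPerfectMatching)
    (m : ℕ) : ∀ W : Finset V, W.card ≤ m → (∀ a ∈ W, ∀ b, F.Adj a b → b ∈ W) → PM G W := by
  induction m with
  | zero =>
    intro W hW _
    have : W = ∅ := by simpa using hW
    subst this
    exact PM.nil
  | succ m ih =>
    intro W hW hcl
    rcases W.eq_empty_or_nonempty with rfl | ⟨x, hx⟩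
    · exact PM.nil
    obtain ⟨y, hxy, -⟩ := Subgraph.isPerfectMatching_iff.1 hF x
    have hy := hcl x hx y hxy
    refine PM.step W x y hx hy hxy.adj_sub (ih _ ?_ ?_)
    · have : (W \ {x, y}).card < W.card := by
        apply Finset.card_lt_card
        rw [Finset.ssubset_iff_of_subset Finset.sdiff_subset]
        exact ⟨x, hx, by simp⟩
      omega
    · intro a ha b hab
      simp at ha ⊢
      refine ⟨hcl a ha.1 b hab, ?_, ?_⟩
      · rintro rfl
        exact ha.2.2 (hF.1.eq_of_adj_left hab.symm hxy)
      · rintro rfl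
        exact ha.2.1 (hF.1.eq_of_adj_left hab.symm hxy.symm)

open Classical in
lemma ext_of {V : Type*} [Fintype V] {G : SimpleGraph V} {n : ℕ} (h : G.IsNExtendable n) (j : ℕ) :
    ∀ (M F : G.Subgraph) (k : ℕ), Good M k → F.IsPerfectMatching → M ≤ F → k + j = n →
    Ext G j (Finset.univ.filter fun z => z ∉ M.verts) := by
  have hpm : ∀ (M F : G.Subgraph) (k : ℕ), Good M k → F.IsPerfectMatching → M ≤ F →
      PM G (Finset.univ.filter fun z => z ∉ M.verts) := by
    intro M F k hM hF hMF
    refine pm_of hF _ _ le_rfl ?_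
    intro a ha b hab
    simp at ha ⊢
    intro hb
    obtain ⟨r, hr, -⟩ := hM.mat hb
    have h2 := hF.1.eq_of_adj_left (hMF.2 hr) hab.symm
    subst h2
    exact ha (M.edge_vert hr.symm)
  induction j with
  | zero =>
    intro M F k hM hF hMF hk
    exact hpm M F k hM hF hMF
  | succ j ih =>
    intro M F k hM hF hMF hk
    refine ⟨hpm M F k hM hF hMF, ?_⟩
    intro x hx y hy hxy
    simp at hx hy
    obtain ⟨F', h1, h2⟩ := extend h j M F k hM hF hMF (by omega) x y hxy hx hy
    have := ih _ F' (k+1) (hM.add hxy hx hy) h1 h2 (by omega)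
    convert this using 1
    ext z
    simp
    tauto

end NExt

/-- Every `n`-extendable graph has minimum degree at least `n + 1`. -/
theorem nExtendable_minDegree {V : Type*} [Fintype V] (G : SimpleGraph V)
    [DecidableRel G.Adj] (n : ℕ) (h : G.IsNExtendable n) :
    ∀ v : V, n + 1 ≤ G.degree v := by
  classical
  intro v
  obtain ⟨M, hM, hMn⟩ := h.2.2.1
  obtain ⟨F, hF, -⟩ := h.2.2.2 M hM hMn
  have hE := NExt.ext_of h n ⊥ F 0 NExt.Good.bot hF bot_le (by omega)
  have hu : (Finset.univ.filter fun z => z ∉ (⊥ : G.Subgraph).verts) = Finset.univ := by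
    ext z; simp
  rw [hu] at hE
  have key := NExt.main G n Finset.univ v (Finset.mem_univ v) hE (by
    intro A hA hv
    have : A = Finset.univ := by
      ext z
      simp only [Finset.mem_univ, iff_true]
      obtain ⟨w⟩ := h.1.preconnected v z
      induction w with
      | nil => exact hv
      | cons hab _ ih => exact ih (hA.2 _ hv _ (Finset.mem_univ _) hab)
    rw [this, Finset.card_univ]
    exact h.2.1)
  have hd : (Finset.univ.filter fun u => G.Adj v u).card = G.degree v := by
    rw [← SimpleGraph.card_neighborFinset_eq_degree, SimpleGraph.neighborFinset_eq_filter]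
  rw [← hd]
  convert key
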